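/- arXiv:2604.15511 — 2 statements merged into one kernel-verified Lean document; each statement's English description precedes it below -/
import Mathlib

section
/- Let n ≥ 1 and r be integers with 1 ≤ r ≤ n, let c be an integer, and let B be a real number with B ≥ 2n+1. Let A′ be an admissible (r+1)×(r+1) matrix and let A be its leading principal r×r submatrix (which is also admissible). Let L′ ∈ ℝ^{r+1} have entries L′_q = m_q·B^(c−q) for q = 1,…,r+1, where each m_q is an integer with 1 ≤ m_q ≤ n, and let L ∈ ℝ^r consist of the first r entries of L′. Set y′ = (A′)^{−1}·L′ and y = A^{−1}·L. Then |y′_q − y_q| < n·2^n·B^(c−(r+1)) for every q ∈ {1,…,r}. (Paper: Lemma that the metrics on a tree and on its contraction along the last edge differ by at most n·2^n·B^(n−3−(r+1)), Section 8, where c = n−3 and A′, A are the path matrices of the (*)-tuples before and after contraction.) -/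
namespace TropPsi

/-- An `r × r` real matrix is *admissible* if it is upper triangular, every
diagonal entry equals `1`, and every entry strictly above the diagonal lies in
`{0, 1}`. -/
def Admissible {r : ℕ} (A : Matrix (Fin r) (Fin r) ℝ) : Prop :=
  (∀ q q' : Fin r, q' < q → A q q' = 0) ∧
  (∀ q : Fin r, A q q = 1) ∧
  (∀ q q' : Fin r, q < q' → A q q' = 0 ∨ A q q' = 1)

namespace Admissible

variable {r : ℕ}

theorem det_eq_one {A : Matrix (Fin r) (Fin r) ℝ} (hA : Admissible A) : A.det = 1 := by
  have h : A.IsUpperTriangular := fun i j hij => hA.1 i j hij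
  rw [Matrix.det_of_isUpperTriangular h]
  exact Finset.prod_eq_one fun q _ => hA.2.1 q

theorem mulVec_inv_mulVec {A : Matrix (Fin r) (Fin r) ℝ} (hA : Admissible A)
    (v : Fin r → ℝ) : A.mulVec (A⁻¹.mulVec v) = v := by
  rw [Matrix.mulVec_mulVec, Matrix.mul_nonsing_inv A (by simp [hA.det_eq_one]),
    Matrix.one_mulVec]

theorem submatrix {s : ℕ} {A : Matrix (Fin r) (Fin r) ℝ} (hA : Admissible A)
    {f : Fin s → Fin r} (hf : StrictMono f) : Admissible (A.submatrix f f) :=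
  ⟨fun _ _ h => hA.1 _ _ (hf h), fun _ => hA.2.1 _, fun _ _ h => hA.2.2 _ _ (hf h)⟩

theorem abs_le_one {A : Matrix (Fin r) (Fin r) ℝ} (hA : Admissible A) (i j : Fin r) :
    |A i j| ≤ 1 := by
  rcases lt_trichotomy i j with h | rfl | h
  · rcases hA.2.2 i j h with h | h <;> simp [h]
  · simp [hA.2.1 i]
  · simp [hA.1 i j h]

/-- If all entries of `A d` are bounded by `T`, back substitution bounds the `ℓ¹` norm of `d`. -/
theorem sum_abs_le {T : ℝ} {A : Matrix (Fin r) (Fin r) ℝ} (hA : Admissible A)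
    {d : Fin r → ℝ} (hd : ∀ q, |A.mulVec d q| ≤ T) : ∑ q, |d q| ≤ (2 ^ r - 1) * T := by
  induction r with
  | zero => simp
  | succ r ih =>
    have hS := ih (d := fun i => d i.succ) (hA.submatrix Fin.strictMono_succ) fun q => by
      have h := hd q.succ
      simp only [Matrix.mulVec, dotProduct, Fin.sum_univ_succ] at h
      simpa [Matrix.mulVec, dotProduct, hA.1 q.succ 0 (Fin.succ_pos q)] using h
    have hsum : |∑ i : Fin r, A 0 i.succ * d i.succ| ≤ ∑ i : Fin r, |d i.succ| := by
      refine (Finset.abs_sum_le_sum_abs _ _).trans (Finset.sum_le_sum fun i _ => ?_)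
      rw [abs_mul]
      exact mul_le_of_le_one_left (abs_nonneg _) (hA.abs_le_one _ _)
    have h0 : |d 0| ≤ T + ∑ i : Fin r, |d i.succ| := by
      have h := hd 0
      simp only [Matrix.mulVec, dotProduct, Fin.sum_univ_succ, hA.2.1 0, one_mul] at h
      have := abs_sub_abs_le_abs_sub (d 0) (-∑ i : Fin r, A 0 i.succ * d i.succ)
      rw [abs_neg, sub_neg_eq_add] at this
      linarith
    rw [Fin.sum_univ_succ, pow_succ]
    linarith

/-- Deleting the last row and column of an admissible system changes the solution by at most
`2 ^ r - 1` times the last entry of the right-hand side. -/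
theorem abs_inv_mulVec_sub_le {A : Matrix (Fin (r + 1)) (Fin (r + 1)) ℝ} (hA : Admissible A)
    (L : Fin (r + 1) → ℝ) (q : Fin r) :
    |(A⁻¹.mulVec L) q.castSucc -
      ((A.submatrix Fin.castSucc Fin.castSucc)⁻¹.mulVec (fun q : Fin r => L q.castSucc)) q| ≤
      (2 ^ r - 1) * |L (Fin.last r)| := by
  have hA₀ := hA.submatrix (Fin.strictMono_castSucc (n := r))
  have hy' := hA.mulVec_inv_mulVec L
  have hy := hA₀.mulVec_inv_mulVec (fun q : Fin r => L q.castSucc)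
  set y' := A⁻¹.mulVec L
  set y := (A.submatrix Fin.castSucc Fin.castSucc)⁻¹.mulVec (fun q : Fin r => L q.castSucc)
  have hlast : y' (Fin.last r) = L (Fin.last r) := by
    have h := congrFun hy' (Fin.last r)
    simpa [Matrix.mulVec, dotProduct, Fin.sum_univ_castSucc, hA.2.1,
      hA.1 _ _ (Fin.castSucc_lt_last _)] using h
  have hd : ∀ p, |(A.submatrix Fin.castSucc Fin.castSucc).mulVec
      ((fun i : Fin r => y' i.castSucc) - y) p| ≤ |L (Fin.last r)| := by
    intro p
    have h := congrFun hy' p.castSucc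
    simp only [Matrix.mulVec, dotProduct, Fin.sum_univ_castSucc, hlast] at h
    have h' : (A.submatrix Fin.castSucc Fin.castSucc).mulVec
        ((fun i : Fin r => y' i.castSucc) - y) p
        = -(A p.castSucc (Fin.last r) * L (Fin.last r)) := by
      rw [Matrix.mulVec_sub, Pi.sub_apply, hy]
      simp only [Matrix.mulVec, dotProduct, Matrix.submatrix_apply]
      linarith
    rw [h', abs_neg, abs_mul]
    exact mul_le_of_le_one_left (abs_nonneg _) (hA.abs_le_one _ _)
  exact (Finset.single_le_sum (f := fun i : Fin r => |y' i.castSucc - y i|)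
    (fun _ _ => abs_nonneg _) (Finset.mem_univ q)).trans (hA₀.sum_abs_le hd)

end Admissible

/-- Lemma that the metrics on a tree and on its contraction
along the last edge differ by at most `n·2^n·B^(c−(r+1))`, Section 8. -/
theorem statement_16
    (n r : ℕ) (hr : 1 ≤ r) (hrn : r ≤ n) (hn : 1 ≤ n) (c : ℤ)
    (B : ℝ) (hB : 2 * (n : ℝ) + 1 ≤ B)
    (A' : Matrix (Fin (r + 1)) (Fin (r + 1)) ℝ) (hA' : Admissible A')
    (m : Fin (r + 1) → ℤ) (hm : ∀ q, 1 ≤ m q ∧ m q ≤ n)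
    (L' : Fin (r + 1) → ℝ)
    (hL' : ∀ q : Fin (r + 1), L' q = (m q : ℝ) * B ^ (c - ((q : ℕ) : ℤ) - 1)) :
    ∀ q : Fin r,
      |(A'⁻¹.mulVec L') q.castSucc -
        ((A'.submatrix Fin.castSucc Fin.castSucc)⁻¹.mulVec
          (fun q : Fin r => L' q.castSucc)) q| <
      (n : ℝ) * 2 ^ n * B ^ (c - (r + 1 : ℤ)) := by
  intro q
  refine (hA'.abs_inv_mulVec_sub_le L' q).trans_lt ?_
  have hn0 : (1 : ℝ) ≤ n := by exact_mod_cast hn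
  have hP : 0 < B ^ (c - (r + 1 : ℤ)) := zpow_pos (by linarith) _
  obtain ⟨hm1, hmn⟩ := hm (Fin.last r)
  have hm1' : (1 : ℝ) ≤ m (Fin.last r) := by exact_mod_cast hm1
  have hmn' : (m (Fin.last r) : ℝ) ≤ n := by exact_mod_cast hmn
  have hL : |L' (Fin.last r)| ≤ n * B ^ (c - (r + 1 : ℤ)) := by
    rw [hL', Fin.val_last, sub_sub, abs_of_nonneg (mul_nonneg (by linarith) hP.le)]
    exact mul_le_mul_of_nonneg_right hmn' hP.le
  have h1 : (1 : ℝ) ≤ 2 ^ r := one_le_pow₀ (by norm_num)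
  have h2 : (2 : ℝ) ^ r ≤ 2 ^ n := pow_le_pow_right₀ (by norm_num) hrn
  calc (2 ^ r - 1) * |L' (Fin.last r)|
      ≤ (2 ^ r - 1) * (n * B ^ (c - (r + 1 : ℤ))) :=
        mul_le_mul_of_nonneg_left hL (by linarith)
    _ < 2 ^ n * (n * B ^ (c - (r + 1 : ℤ))) :=
        mul_lt_mul_of_pos_right (by linarith) (by positivity)
    _ = n * 2 ^ n * B ^ (c - (r + 1 : ℤ)) := by ring

end TropPsi
end

section
/- Fix an integer n ≥ 3, a subset S ⊆ {1,…,n} with |S| ≥ 3, and distinct elements i, j ∈ S. Let P be the free ℤ-module on the set of 2-element subsets of {1,…,n}, let ι : ℤ^n → P be the ℤ-linear map defined by ι(x)_{{a,b}} = x_a + x_b for every 2-element subset {a,b}, and let Q be the quotient of the free ℤ-module ℤ^{S∖{i,j}} by the subgroup generated by the all-ones vector. Then the ℤ-linear map G : P → Q sending p to the class of the vector (p_{{j,ℓ}} − p_{{i,ℓ}})_{ℓ ∈ S∖{i,j}} vanishes on the image of ι, and the induced ℤ-linear map P/ι(ℤ^n) → Q is surjective. (Paper: Lemma that the monomial map G_{i,j}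 ∘ π_S of tori corresponds to a surjective map of lattices, Section 5.) -/
namespace TropPsi

/-- The set of 2-element subsets of `{1,…,n}`, indexing the Plücker
coordinates. -/
def PairIdx (n : ℕ) : Type := { s : Finset (Fin n) // s.card = 2 }

/-- The map `ι : ℤ^n → ℤ^{pairs}`, `ι(x)_{{a,b}} = x_a + x_b`. -/
def iota (n : ℕ) (x : Fin n → ℤ) : PairIdx n → ℤ :=
  fun s => ∑ a ∈ s.1, x a

/-- The index set `S ∖ {i, j}`. -/
def OutIdx (n : ℕ) (S : Finset (Fin n)) (i j : Fin n) : Type :=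
  { l : Fin n // l ∈ S ∧ l ≠ i ∧ l ≠ j }

/-- The map `G : ℤ^{pairs} → ℤ^{S∖{i,j}}`, `p ↦ (p_{{j,ℓ}} − p_{{i,ℓ}})_ℓ`. -/
def Gvec (n : ℕ) (S : Finset (Fin n)) (i j : Fin n) (p : PairIdx n → ℤ) :
    OutIdx n S i j → ℤ :=
  fun l =>
    p ⟨{j, l.1}, Finset.card_pair (Ne.symm l.2.2.2)⟩ -
      p ⟨{i, l.1}, Finset.card_pair (Ne.symm l.2.2.1)⟩

/-- The quotient `Q` of `ℤ^{S∖{i,j}}` by the subgroup generated by the all-ones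
vector. -/
abbrev Quot1 (n : ℕ) (S : Finset (Fin n)) (i j : Fin n) :=
  (OutIdx n S i j → ℤ) ⧸ AddSubgroup.zmultiples (1 : OutIdx n S i j → ℤ)

theorem Gvec_iota (n : ℕ) (S : Finset (Fin n)) (i j : Fin n) (x : Fin n → ℤ) :
    Gvec n S i j (iota n x) = (x j - x i) • (1 : OutIdx n S i j → ℤ) := by
  funext l
  simp [Gvec, iota, Finset.sum_pair l.2.2.1.symm, Finset.sum_pair l.2.2.2.symm]

theorem Gvec_surjective (n : ℕ) (S : Finset (Fin n)) {i j : Fin n} (hij : i ≠ j) :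
    Function.Surjective (Gvec n S i j) := by
  classical
  intro v
  let w : Fin n → ℤ := fun l => if h : l ∈ S ∧ l ≠ i ∧ l ≠ j then v ⟨l, h⟩ else 0
  have hwj : w j = 0 := dif_neg fun h => h.2.2 rfl
  refine ⟨fun s => if j ∈ s.1 then ∑ a ∈ s.1, w a else 0, funext fun l => ?_⟩
  have hwl : w l.1 = v l := dif_pos l.2
  simp [Gvec, Finset.sum_pair l.2.2.2.symm, hwj, hwl, hij.symm, l.2.2.2.symm]

/-- Lemma that the monomial map `G_{i,j} ∘ π_S` of tori
corresponds to a surjective map of lattices, Section 5: the ℤ-linear map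
`G : P → Q` vanishes on the image of `ι`, hence induces a map
`P/ι(ℤ^n) → Q`, and this induced map is surjective (equivalently, the composite
`P → Q` is surjective). -/
theorem statement_17
    (n : ℕ) (hn : 3 ≤ n)
    (S : Finset (Fin n)) (hS : 3 ≤ S.card)
    (i j : Fin n) (hi : i ∈ S) (hj : j ∈ S) (hij : i ≠ j) :
    -- `G` is ℤ-linear …
    (∀ p p' : PairIdx n → ℤ,
      Gvec n S i j (p + p') = Gvec n S i j p + Gvec n S i j p') ∧
    (∀ (z : ℤ) (p : PairIdx n → ℤ), Gvec n S i j (z • p) = z • Gvec n S i j p) ∧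
    -- … vanishes on the image of `ι` …
    (∀ x : Fin n → ℤ,
      (QuotientAddGroup.mk (Gvec n S i j (iota n x)) : Quot1 n S i j) = 0) ∧
    -- … and the induced map `P/ι(ℤ^n) → Q` is surjective
    Function.Surjective
      (fun p : PairIdx n → ℤ =>
        (QuotientAddGroup.mk (Gvec n S i j p) : Quot1 n S i j)) := by
  refine ⟨fun p p' => ?_, fun z p => ?_, fun x => ?_,
    QuotientAddGroup.mk_surjective.comp (Gvec_surjective n S hij)⟩
  · exact funext fun _ => add_sub_add_comm _ _ _ _
  · exact funext fun _ => (smul_sub z _ _).symm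
  · rw [QuotientAddGroup.eq_zero_iff, Gvec_iota]
    exact AddSubgroup.zsmul_mem_zmultiples _ _

end TropPsi
end
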